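/- arXiv:2405.12009 — 3 statements merged into one kernel-verified Lean document; each statement's English description precedes it below -/
import Mathlib

section
/- Let I and I′ be primitive isotropic sublattices of rank 2 in H ⊕ H, and let e ∈ I and e′ ∈ I′ be primitive vectors. Then there exists an isometry g of H ⊕ H such that g(I) = I′ and g(e) = e′. -/
/- Background definitions: integral lattices, the hyperbolic plane `H`, the
   `E₈` lattice, the K3 lattice `Λ_K3 = H ⊕ H ⊕ H ⊕ E₈ ⊕ E₈`, primitivity,
   isotropy, and (doubly) admissible classes. -/

namespace DF

/-- Integer bilinear form on a `ℤ`-module. -/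
abbrev Bil (G : Type) [AddCommGroup G] := G →ₗ[ℤ] G →ₗ[ℤ] ℤ

section Defs

variable {G G' : Type} [AddCommGroup G] [AddCommGroup G']

/-- A primitive element of a free `ℤ`-module. -/
def PrimElt (p : G) : Prop := ∀ (n : ℤ) (x : G), p = n • x → IsUnit n

/-- A primitive subgroup (torsion-free quotient). -/
def PrimSub (S : Submodule ℤ G) : Prop :=
  ∀ (n : ℤ) (x : G), n ≠ 0 → n • x ∈ S → x ∈ S

/-- `S` is a primitive subgroup of `T` (i.e. `T/S` is torsion-free). -/
def PrimIn (S T : Submodule ℤ G) : Prop :=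
  ∀ (n : ℤ) (x : G), n ≠ 0 → x ∈ T → n • x ∈ S → x ∈ S

/-- `e` is a primitive element of the subgroup `S`. -/
def PrimEltIn (S : Submodule ℤ G) (e : G) : Prop :=
  ∀ (n : ℤ) (x : G), x ∈ S → e = n • x → IsUnit n

/-- The bilinear form vanishes identically on `S`. -/
def IsotropicSub (B : Bil G) (S : Submodule ℤ G) : Prop :=
  ∀ x ∈ S, ∀ y ∈ S, B x y = 0

/-- The restriction of `B` to `S` is nondegenerate. -/
def NondegOn (B : Bil G) (S : Submodule ℤ G) : Prop :=
  ∀ x ∈ S, (∀ y ∈ S, B x y = 0) → x = 0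

/-- The (two-sided) orthogonal complement of a submodule. -/
def perpSub (B : Bil G) (S : Submodule ℤ G) : Submodule ℤ G where
  carrier := {v | ∀ s ∈ S, B s v = 0 ∧ B v s = 0}
  zero_mem' := by intro s hs; simp
  add_mem' := by
    intro x y hx hy s hs
    obtain ⟨h1, h2⟩ := hx s hs; obtain ⟨h3, h4⟩ := hy s hs
    constructor <;> simp [map_add, LinearMap.add_apply, h1, h2, h3, h4]
  smul_mem' := by
    intro c x hx s hs
    obtain ⟨h1, h2⟩ := hx s hs
    constructor <;> simp [map_smul, LinearMap.smul_apply, smul_eq_mul, h1, h2]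

/-- The submodule `N` of `(G, B)` is isometric to the lattice `(G', B')`. -/
def IsometricTo (B : Bil G) (N : Submodule ℤ G) (B' : Bil G') : Prop :=
  ∃ e : G' ≃ₗ[ℤ] ↥N, ∀ u v : G', B ((e u : ↥N) : G) ((e v : ↥N) : G) = B' u v

/-- `div(e) = m` in `S`: the image of `⟨e, -⟩ : S → ℤ` is generated by `m`. -/
def DivEq (B : Bil G) (S : Submodule ℤ G) (e : G) (m : ℤ) : Prop :=
  (∀ x ∈ S, m ∣ B e x) ∧ ∃ x ∈ S, B e x = m

/-- `e` is an `m`-admissible class of the (nondegenerate) lattice `S`: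
    `e ∈ S` is primitive isotropic with `div(e) = m`, and there is an
    isotropic `g ∈ S` with `div(g) = m` and `⟨e, g⟩ = m`. -/
def MAdm (B : Bil G) (S : Submodule ℤ G) (e : G) (m : ℤ) : Prop :=
  e ∈ S ∧ PrimEltIn S e ∧ B e e = 0 ∧ DivEq B S e m ∧
  ∃ g ∈ S, B g g = 0 ∧ DivEq B S g m ∧ B e g = m

/-- The rank-two isotropic sublattice `I` of `S` is doubly admissible in `S`:
    there are primitive generators `e₁, e₂` of `I` and isotropic classes
    `g₁, g₂ ∈ S` with `⟨e₁,g₁⟩ = ⟨e₂,g₂⟩ = 1` and `⟨e₁,g₂⟩ = ⟨e₂,g₁⟩ = 0`. -/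
def DoublyAdm (B : Bil G) (S : Submodule ℤ G) (I : Submodule ℤ G) : Prop :=
  ∃ e₁ e₂ g₁ g₂ : G, e₁ ∈ S ∧ e₂ ∈ S ∧ g₁ ∈ S ∧ g₂ ∈ S ∧
    PrimEltIn S e₁ ∧ PrimEltIn S e₂ ∧ I = Submodule.span ℤ {e₁, e₂} ∧
    B g₁ g₁ = 0 ∧ B g₂ g₂ = 0 ∧
    B e₁ g₁ = 1 ∧ B e₂ g₂ = 1 ∧ B e₁ g₂ = 0 ∧ B e₂ g₁ = 0

/-- Signature `(1, rank - 1)` for the sublattice `L`: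
    there is a rationally spanning pairwise orthogonal family in `L` with one
    vector of positive square and `rank L - 1` of negative square. -/
def SigOneRest (B : Bil G) (L : Submodule ℤ G) : Prop :=
  1 ≤ Module.finrank ℤ ↥L ∧
  ∃ (v₀ : G) (w : Fin (Module.finrank ℤ ↥L - 1) → G),
    v₀ ∈ L ∧ (∀ i, w i ∈ L) ∧ 0 < B v₀ v₀ ∧ (∀ i, B (w i) (w i) < 0) ∧
    (∀ i, B v₀ (w i) = 0) ∧ (∀ i j, i ≠ j → B (w i) (w j) = 0) ∧
    ∀ u ∈ L, ∃ m : ℤ, m ≠ 0 ∧ m • u ∈ Submodule.span ℤ (insert v₀ (Set.range w))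

end Defs

section Lattices

variable {G₁ G₂ : Type} [AddCommGroup G₁] [AddCommGroup G₂]

/-- The orthogonal direct sum of two bilinear forms. -/
def prodForm (B₁ : Bil G₁) (B₂ : Bil G₂) : Bil (G₁ × G₂) :=
  LinearMap.mk₂ ℤ (fun u v => B₁ u.1 v.1 + B₂ u.2 v.2)
    (by intro m₁ m₂ n; simp [map_add, LinearMap.add_apply]; ring)
    (by intro c m n; simp [map_smul, LinearMap.smul_apply, smul_eq_mul]; ring)
    (by intro m n₁ n₂; simp [map_add, LinearMap.add_apply]; ring)
    (by intro c m n; simp [map_smul, LinearMap.smul_apply, smul_eq_mul]; ring)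

/-- The hyperbolic plane `H`: `ℤ²` with Gram matrix `!![0, 1; 1, 0]`. -/
def HForm : Bil (Fin 2 → ℤ) :=
  LinearMap.mk₂ ℤ (fun x y => x 0 * y 1 + x 1 * y 0)
    (by intro m₁ m₂ n; simp [Pi.add_apply]; ring)
    (by intro c m n; simp [Pi.smul_apply, smul_eq_mul]; ring)
    (by intro m n₁ n₂; simp [Pi.add_apply]; ring)
    (by intro c m n; simp [Pi.smul_apply, smul_eq_mul]; ring)

/-- The negative of the `E₈` Cartan matrix (Bourbaki numbering). -/
def E8Gram : Matrix (Fin 8) (Fin 8) ℤ :=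
  !![-2,  0,  1,  0,  0,  0,  0,  0;
      0, -2,  0,  1,  0,  0,  0,  0;
      1,  0, -2,  1,  0,  0,  0,  0;
      0,  1,  1, -2,  1,  0,  0,  0;
      0,  0,  0,  1, -2,  1,  0,  0;
      0,  0,  0,  0,  1, -2,  1,  0;
      0,  0,  0,  0,  0,  1, -2,  1;
      0,  0,  0,  0,  0,  0,  1, -2]

/-- The negative definite even unimodular root lattice `E₈`. -/
def E8Form : Bil (Fin 8 → ℤ) := Matrix.toLinearMap₂' ℤ E8Gram

/-- The underlying group of `H ⊕ H`. -/
abbrev HHtype := (Fin 2 → ℤ) × (Fin 2 → ℤ)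

/-- The lattice `H ⊕ H`. -/
def HHForm : Bil HHtype := prodForm HForm HForm

/-- The underlying group of `H ⊕ E₈ ⊕ E₈`. -/
abbrev HEEtype := (Fin 2 → ℤ) × (Fin 8 → ℤ) × (Fin 8 → ℤ)

/-- The lattice `H ⊕ E₈ ⊕ E₈`. -/
def HEEForm : Bil HEEtype := prodForm HForm (prodForm E8Form E8Form)

/-- The underlying group of the K3 lattice `Λ_K3 = H ⊕ H ⊕ H ⊕ E₈ ⊕ E₈`. -/
abbrev K3type := (Fin 2 → ℤ) × (Fin 2 → ℤ) × (Fin 2 → ℤ) × (Fin 8 → ℤ) × (Fin 8 → ℤ)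

/-- The K3 lattice `Λ_K3 = H ⊕ H ⊕ H ⊕ E₈ ⊕ E₈`. -/
def K3Form : Bil K3type :=
  prodForm HForm (prodForm HForm (prodForm HForm (prodForm E8Form E8Form)))

end Lattices

end DF

namespace DF

theorem HHForm_apply (x y : HHtype) :
    HHForm x y = x.1 0 * y.1 1 + x.1 1 * y.1 0 + (x.2 0 * y.2 1 + x.2 1 * y.2 0) := rfl

theorem HHForm_comm (x y : HHtype) : HHForm x y = HHForm y x := by
  simp only [HHForm_apply]; ring

theorem exists_HHForm_self_eq_two_mul (x : HHtype) : ∃ k, HHForm x x = 2 * k :=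
  ⟨x.1 0 * x.1 1 + x.2 0 * x.2 1, by simp only [HHForm_apply]; ring⟩

theorem exists_bezout (a b : ℤ) :
    ∃ d a' b' s t : ℤ, a = d * a' ∧ b = d * b' ∧ a * s + b * t = d := by
  obtain ⟨a', ha⟩ := Int.gcd_dvd_left a b
  obtain ⟨b', hb⟩ := Int.gcd_dvd_right a b
  exact ⟨Int.gcd a b, a', b', Int.gcdA a b, Int.gcdB a b, ha, hb, (Int.gcd_eq_gcd_ab a b).symm⟩

/-- Every vector of `H ⊕ H` is a multiple of its divisibility. -/
theorem exists_eq_smul_and_HHForm_eq (x : HHtype) :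
    ∃ (d : ℤ) (y z : HHtype), x = d • y ∧ HHForm x z = d := by
  obtain ⟨d₁, a, b, s, t, ha, hb, h₁⟩ := exists_bezout (x.1 0) (x.1 1)
  obtain ⟨d₂, a', b', s', t', ha', hb', h₂⟩ := exists_bezout (x.2 0) (x.2 1)
  obtain ⟨d, p, q, m, n, hp, hq, h⟩ := exists_bezout d₁ d₂
  refine ⟨d, (![p * a, p * b], ![q * a', q * b']), (![m * t, m * s], ![n * t', n * s']), ?_, ?_⟩
  · ext i <;> fin_cases i <;>
      simp [ha, hb, ha', hb'] <;> simp only [← mul_assoc, ← hp, ← hq]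
  · simp only [HHForm_apply, Matrix.cons_val_zero, Matrix.cons_val_one]
    linear_combination m * h₁ + n * h₂ + h

/-- A dual vector to `x` can be corrected by a multiple of the isotropic vector `x` so as to
become isotropic. -/
theorem exists_isotropic_sub_smul {x y : HHtype} (hx : HHForm x x = 0) (hxy : HHForm x y = 1) :
    ∃ k : ℤ, HHForm (y - k • x) (y - k • x) = 0 := by
  obtain ⟨k, hk⟩ := exists_HHForm_self_eq_two_mul y
  refine ⟨k, ?_⟩
  simp only [map_sub, map_smul, LinearMap.sub_apply, LinearMap.smul_apply, smul_eq_mul, hk, hx,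
    hxy, HHForm_comm y x]
  ring

/-- A pair of orthogonal hyperbolic pairs gives an isometry of `H ⊕ H`. -/
theorem exists_isometry_of_hyperbolic_pairs {e u f v : HHtype}
    (hee : HHForm e e = 0) (huu : HHForm u u = 0) (hff : HHForm f f = 0) (hvv : HHForm v v = 0)
    (heu : HHForm e u = 1) (hfv : HHForm f v = 1) (hef : HHForm e f = 0) (hev : HHForm e v = 0)
    (hfu : HHForm f u = 0) (huv : HHForm u v = 0) :
    ∃ g : HHtype ≃ₗ[ℤ] HHtype, (∀ x y, HHForm (g x) (g y) = HHForm x y) ∧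
      ∀ x, g x = x.1 0 • e + x.1 1 • u + (x.2 0 • f + x.2 1 • v) := by
  let G : HHtype →ₗ[ℤ] HHtype :=
    { toFun := fun x => x.1 0 • e + x.1 1 • u + (x.2 0 • f + x.2 1 • v)
      map_add' := by intro x y; simp only [Prod.fst_add, Prod.snd_add, Pi.add_apply]; module
      map_smul' := by
        intro c x
        simp only [Prod.smul_fst, Prod.smul_snd, Pi.smul_apply, smul_eq_mul, RingHom.id_apply]
        module }
  have hG (x) : G x = x.1 0 • e + x.1 1 • u + (x.2 0 • f + x.2 1 • v) := rfl
  let K : HHtype →ₗ[ℤ] HHtype :=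
    { toFun := fun w => (![HHForm u w, HHForm e w], ![HHForm v w, HHForm f w])
      map_add' := by intro x y; simp
      map_smul' := by intro c x; simp [-zsmul_eq_mul] }
  have hK (x) : K x = (![HHForm u x, HHForm e x], ![HHForm v x, HHForm f x]) := rfl
  have hKG : K ∘ₗ G = LinearMap.id := by
    refine LinearMap.ext fun x => ?_
    rw [LinearMap.comp_apply, hK, hG, LinearMap.id_apply]
    ext i <;> fin_cases i <;>
      simp [-zsmul_eq_mul, hee, huu, hff, hvv, heu, hfv, hef, hev, hfu, huv, HHForm_comm u e, HHForm_comm v f,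
        HHForm_comm f e, HHForm_comm v e, HHForm_comm u f, HHForm_comm v u]
  refine ⟨LinearEquiv.ofLinearMap G K (mul_eq_one_comm.mp hKG) hKG, fun x y => ?_,
    fun x => rfl⟩
  rw [LinearEquiv.coe_ofLinearMap, hG, hG]
  simp only [map_add, map_smul, LinearMap.add_apply, LinearMap.smul_apply, smul_eq_mul,
    hee, huu, hff, hvv, heu, hfv, hef, hev, hfu, huv, HHForm_comm u e, HHForm_comm v f,
    HHForm_comm f e, HHForm_comm v e, HHForm_comm u f, HHForm_comm v u, HHForm_apply x y]
  ring

/-- An isotropic plane is moved to the standard one, with a given primitive vector moved to the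
first standard basis vector. -/
theorem exists_isometry_to_standard {I : Submodule ℤ HHtype} (hprim : PrimSub I)
    (hiso : IsotropicSub HHForm I) (hrk : Module.finrank ℤ I = 2) {e : HHtype} (heI : e ∈ I)
    (he : PrimElt e) :
    ∃ g : HHtype ≃ₗ[ℤ] HHtype, (∀ x y, HHForm (g x) (g y) = HHForm x y) ∧
      (∀ x, g x ∈ I ↔ x.1 1 = 0 ∧ x.2 1 = 0) ∧ g (![1, 0], 0) = e := by
  have hee := hiso e heI e heI
  obtain ⟨u₀, hu₀⟩ : ∃ u₀, HHForm e u₀ = 1 := by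
    obtain ⟨d, y, z, hy, hz⟩ := exists_eq_smul_and_HHForm_eq e
    refine ⟨d • z, ?_⟩
    rw [map_smul, hz, smul_eq_mul]
    exact Int.isUnit_mul_self (he d y hy)
  obtain ⟨k, hk⟩ := exists_isotropic_sub_smul hee hu₀
  obtain ⟨u, huu, heu⟩ : ∃ u, HHForm u u = 0 ∧ HHForm e u = 1 :=
    ⟨_, hk, by simp [-zsmul_eq_mul, hee, hu₀]⟩
  obtain ⟨x, hxI, hxu, hx0⟩ : ∃ x ∈ I, HHForm x u = 0 ∧ x ≠ 0 := by
    by_contra! hne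
    have hle : I ≤ Submodule.span ℤ {e} := fun w hw => by
      have h := hne (w - HHForm w u • e) (I.sub_mem hw (I.smul_mem _ heI)) (by simp [-zsmul_eq_mul, heu])
      exact Submodule.mem_span_singleton.mpr ⟨_, (sub_eq_zero.mp h).symm⟩
    have h₁ := Submodule.finrank_mono hle
    have h₂ := finrank_span_le_card (R := ℤ) ({e} : Set HHtype)
    simp only [Set.toFinset_singleton, Finset.card_singleton] at h₂
    omega
  obtain ⟨d, f, v₀, hxf, hxv⟩ := exists_eq_smul_and_HHForm_eq x
  have hd : d ≠ 0 := by rintro rfl; exact hx0 (by simpa using hxf)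
  have hfI : f ∈ I := hprim d f hd (hxf ▸ hxI)
  have hfu : HHForm f u = 0 := by
    rw [hxf, map_smul, LinearMap.smul_apply, smul_eq_mul] at hxu
    exact (mul_eq_zero.mp hxu).resolve_left hd
  have hfv₀ : HHForm f v₀ = 1 := by
    rw [hxf, map_smul, LinearMap.smul_apply, smul_eq_mul] at hxv
    exact mul_left_cancel₀ hd (by rw [hxv, mul_one])
  have hef := hiso e heI f hfI
  have hfe := hiso f hfI e heI
  have hff := hiso f hfI f hfI
  have hue := (HHForm_comm u e).trans heu
  have huf := (HHForm_comm u f).trans hfu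
  obtain ⟨v₁, hfv₁, hev₁, huv₁⟩ :
      ∃ v₁, HHForm f v₁ = 1 ∧ HHForm e v₁ = 0 ∧ HHForm u v₁ = 0 :=
    ⟨v₀ - HHForm u v₀ • e - HHForm e v₀ • u, by simp [-zsmul_eq_mul, hfv₀, hfe, hfu],
      by simp [-zsmul_eq_mul, hee, heu], by simp [-zsmul_eq_mul, hue, huu]⟩
  obtain ⟨l, hvv⟩ := exists_isotropic_sub_smul hff hfv₁
  obtain ⟨g, hg, hgx⟩ := exists_isometry_of_hyperbolic_pairs (v := v₁ - l • f) hee huu hff hvv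
    heu (by simp [-zsmul_eq_mul, hfv₁, hff]) hef (by simp [-zsmul_eq_mul, hev₁, hef]) hfu
    (by simp [-zsmul_eq_mul, huv₁, huf])
  have hge : g (![1, 0], 0) = e := by simp [hgx]
  have hgf : g (0, ![1, 0]) = f := by simp [hgx]
  refine ⟨g, hg, fun x => ⟨fun hx => ?_, fun ⟨h₁, h₂⟩ => ?_⟩, hge⟩
  · have h₁ := hiso _ heI _ hx
    have h₂ := hiso _ hfI _ hx
    rw [← hge, hg] at h₁
    rw [← hgf, hg] at h₂
    exact ⟨by simpa [HHForm_apply] using h₁, by simpa [HHForm_apply] using h₂⟩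
  · rw [hgx, h₁, h₂, zero_smul, zero_smul, add_zero, add_zero]
    exact I.add_mem (I.smul_mem _ heI) (I.smul_mem _ hfI)

end DF

open DF in
/-- Let `I` and `I'` be primitive isotropic sublattices of
rank 2 in `H ⊕ H`, and let `e ∈ I` and `e' ∈ I'` be primitive vectors. Then
there is an isometry `g` of `H ⊕ H` with `g(I) = I'` and `g(e) = e'`. -/
theorem stmt13 (I I' : Submodule ℤ HHtype)
    (hIprim : PrimSub I) (hI'prim : PrimSub I')
    (hIiso : IsotropicSub HHForm I) (hI'iso : IsotropicSub HHForm I')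
    (hIrk : Module.finrank ℤ ↥I = 2) (hI'rk : Module.finrank ℤ ↥I' = 2)
    (e e' : HHtype) (heI : e ∈ I) (he'I' : e' ∈ I')
    (he : PrimElt e) (he' : PrimElt e') :
    ∃ g : HHtype ≃ₗ[ℤ] HHtype,
      (∀ u v, HHForm (g u) (g v) = HHForm u v) ∧
      Submodule.map (g : HHtype →ₗ[ℤ] HHtype) I = I' ∧
      g e = e' := by
  obtain ⟨g, hg, hgI, hge⟩ := exists_isometry_to_standard hIprim hIiso hIrk heI he
  obtain ⟨g', hg', hgI', hge'⟩ := exists_isometry_to_standard hI'prim hI'iso hI'rk he'I' he'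
  refine ⟨g.symm.trans g', fun u v => ?_, ?_, ?_⟩
  · rw [LinearEquiv.trans_apply, LinearEquiv.trans_apply, hg', ← hg, g.apply_symm_apply,
      g.apply_symm_apply]
  · ext w
    rw [Submodule.mem_map]
    constructor
    · rintro ⟨x, hx, rfl⟩
      rw [← g.apply_symm_apply x, hgI] at hx
      exact (hgI' _).mpr hx
    · intro hw
      rw [← g'.apply_symm_apply w, hgI'] at hw
      exact ⟨g (g'.symm w), (hgI _).mpr hw, by simp⟩
  · rw [LinearEquiv.trans_apply, ← hge, g.symm_apply_apply, hge']
end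

section
/- Let L be a nondegenerate primitive sublattice of the K3 lattice Λ_K3 and let I be a primitive rank-2 isotropic sublattice of L^⊥. The following are equivalent: (1) I is doubly admissible in L^⊥; (2) the inclusion I ↪ L^⊥ factors as a composite of primitive isometric embeddings I ↪ M ↪ L^⊥ where M is a lattice isometric to H ⊕ H; (3) the inclusion L ↪ I^⊥ (the orthogonal complement of I taken in Λ_K3) factors as a composite of primitive isometric embeddings L ↪ N ↪ I^⊥ where N is a lattice isometric to H ⊕ E₈ ⊕ E₈. -/
namespace DF

section Generic

variable {G G₁ G₂ : Type} [AddCommGroup G] [AddCommGroup G₁] [AddCommGroup G₂]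

/-- The form `B` is symmetric. -/
def SymmForm (B : Bil G) : Prop := ∀ x y, B x y = B y x

/-- The form `B` takes even values on the diagonal. -/
def EvenForm (B : Bil G) : Prop := ∀ x, ∃ q, B x x = 2 * q

/-- Every functional is represented by an element. -/
def Unimodular (B : Bil G) : Prop := ∀ φ : G →ₗ[ℤ] ℤ, ∃ x, ∀ y, B x y = φ y

/-- The linear automorphism `σ` preserves `B`. -/
def IsIsometry (B : Bil G) (σ : G ≃ₗ[ℤ] G) : Prop := ∀ u v, B (σ u) (σ v) = B u v

lemma prodForm_apply (B₁ : Bil G₁) (B₂ : Bil G₂) (u v : G₁ × G₂) :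
    prodForm B₁ B₂ u v = B₁ u.1 v.1 + B₂ u.2 v.2 := rfl

lemma SymmForm.prod {B₁ : Bil G₁} {B₂ : Bil G₂} (h₁ : SymmForm B₁) (h₂ : SymmForm B₂) :
    SymmForm (prodForm B₁ B₂) := fun x y => by
  rw [prodForm_apply, prodForm_apply, h₁, h₂]

lemma EvenForm.prod {B₁ : Bil G₁} {B₂ : Bil G₂} (h₁ : EvenForm B₁) (h₂ : EvenForm B₂) :
    EvenForm (prodForm B₁ B₂) := fun x => by
  obtain ⟨p, hp⟩ := h₁ x.1
  obtain ⟨q, hq⟩ := h₂ x.2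
  exact ⟨p + q, by rw [prodForm_apply, hp, hq]; ring⟩

lemma Unimodular.prod {B₁ : Bil G₁} {B₂ : Bil G₂} (h₁ : Unimodular B₁) (h₂ : Unimodular B₂) :
    Unimodular (prodForm B₁ B₂) := fun φ => by
  obtain ⟨x, hx⟩ := h₁ (φ ∘ₗ LinearMap.inl ℤ G₁ G₂)
  obtain ⟨y, hy⟩ := h₂ (φ ∘ₗ LinearMap.inr ℤ G₁ G₂)
  refine ⟨(x, y), fun z => ?_⟩
  rw [prodForm_apply, hx, hy]
  simp [← map_add]

lemma IsIsometry.trans {B : Bil G} {σ τ : G ≃ₗ[ℤ] G} (hσ : IsIsometry B σ)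
    (hτ : IsIsometry B τ) : IsIsometry B (σ.trans τ) := fun u v => by
  simp [hτ _ _, hσ _ _]

lemma IsIsometry.symm {B : Bil G} {σ : G ≃ₗ[ℤ] G} (hσ : IsIsometry B σ) :
    IsIsometry B σ.symm := fun u v => by
  rw [← hσ]; simp

lemma IsIsometry.prod {B₁ : Bil G₁} {B₂ : Bil G₂} {σ : G₁ ≃ₗ[ℤ] G₁} {τ : G₂ ≃ₗ[ℤ] G₂}
    (hσ : IsIsometry B₁ σ) (hτ : IsIsometry B₂ τ) :
    IsIsometry (prodForm B₁ B₂) (σ.prodCongr τ) := fun u v => by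
  simp [prodForm_apply, hσ _ _, hτ _ _]

lemma isIsometry_refl (B : Bil G) : IsIsometry B (LinearEquiv.refl ℤ G) := fun _ _ => rfl

/-- The Eichler transvection `v ↦ v - ⟨y,v⟩e + ⟨e,v⟩y - q⟨e,v⟩e`, as a linear map. -/
def eichlerMap (B : Bil G) (e y : G) (q : ℤ) : G →ₗ[ℤ] G :=
  LinearMap.id - (B y).smulRight e + (B e).smulRight y - q • (B e).smulRight e

lemma eichlerMap_apply (B : Bil G) (e y : G) (q : ℤ) (v : G) :
    eichlerMap B e y q v = v - B y v • e + B e v • y - q • B e v • e := by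
  simp [eichlerMap, smul_comm q]

lemma eichlerMap_neg_apply {B : Bil G} (hB : SymmForm B) {e y : G} {q : ℤ} (he : B e e = 0)
    (hey : B e y = 0) (hy : B y y = 2 * q) (v : G) :
    eichlerMap B e (-y) q (eichlerMap B e y q v) = v := by
  have hye : B y e = 0 := by rw [hB, hey]
  simp only [eichlerMap_apply, map_add, map_sub, map_smul, map_neg, LinearMap.neg_apply,
    he, hey, hye, hy]
  module

/-- The Eichler transvection attached to an isotropic `e` and `y ∈ e^⊥` with `⟨y,y⟩ = 2q`. -/
def eichler {B : Bil G} (hB : SymmForm B) {e y : G} {q : ℤ} (he : B e e = 0)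
    (hey : B e y = 0) (hy : B y y = 2 * q) : G ≃ₗ[ℤ] G :=
  LinearEquiv.ofLinearMap (eichlerMap B e y q) (eichlerMap B e (-y) q)
    (LinearMap.ext fun v => by
      have := eichlerMap_neg_apply hB (y := -y) (q := q) he (by simp [hey]) (by simp [hy]) v
      simpa using this)
    (LinearMap.ext fun v => by simpa using eichlerMap_neg_apply hB he hey hy v)

lemma eichler_apply {B : Bil G} (hB : SymmForm B) {e y : G} {q : ℤ} (he : B e e = 0)
    (hey : B e y = 0) (hy : B y y = 2 * q) (v : G) :
    eichler hB he hey hy v = v - B y v • e + B e v • y - q • B e v • e :=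
  eichlerMap_apply B e y q v

lemma isIsometry_eichler {B : Bil G} (hB : SymmForm B) {e y : G} {q : ℤ} (he : B e e = 0)
    (hey : B e y = 0) (hy : B y y = 2 * q) : IsIsometry B (eichler hB he hey hy) := fun u v => by
  have hye : B y e = 0 := by rw [hB, hey]
  simp only [eichler_apply, map_add, map_sub, map_smul, LinearMap.add_apply, LinearMap.sub_apply,
    LinearMap.smul_apply, smul_eq_mul, he, hey, hye, hy, hB u e, hB u y]
  ring

/-- Two isotropic vectors pairing to `1` with an isotropic `e` are exchanged by an isometry
fixing `e`. -/
lemma exists_isometry_fix {B : Bil G} (hB : SymmForm B) {e f f' : G} (he : B e e = 0)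
    (hf : B f f = 0) (hf' : B f' f' = 0) (hef : B e f = 1) (hef' : B e f' = 1) :
    ∃ σ, IsIsometry B σ ∧ σ e = e ∧ σ f = f' := by
  have hey : B e (f' - f) = 0 := by simp [hef, hef']
  have hy : B (f' - f) (f' - f) = 2 * (-B f f') := by
    simp [hf, hf', hB f' f]; ring
  have hfe : B f e = 1 := by rw [hB, hef]
  have hfe' : B f' e = 1 := by rw [hB, hef']
  refine ⟨eichler hB he hey hy, isIsometry_eichler hB he hey hy, ?_, ?_⟩
  · simp [eichler_apply, he, hfe, hfe']
  · simp [eichler_apply, hef, hf, hB f' f]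

end Generic

section Hyperbolic

variable {G : Type} [AddCommGroup G]

lemma HForm_apply (x y : Fin 2 → ℤ) : HForm x y = x 0 * y 1 + x 1 * y 0 := rfl

lemma symmForm_HForm : SymmForm HForm := fun x y => by
  simp only [HForm_apply]; ring

lemma evenForm_HForm : EvenForm HForm := fun x => ⟨x 0 * x 1, by
  simp only [HForm_apply]; ring⟩

lemma unimodular_HForm : Unimodular HForm := fun φ => by
  refine ⟨![φ ![0, 1], φ ![1, 0]], fun y => ?_⟩
  have : y = y 0 • ![1, 0] + y 1 • ![0, 1] := by
    ext i; fin_cases i <;> simp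
  conv_rhs => rw [this]
  simp only [HForm_apply, map_add, map_smul, smul_eq_mul, Matrix.cons_val_zero,
    Matrix.cons_val_one]
  ring

/-- The vector with coordinates `(a, b)`, `(c, d)`, `z` in `H ⊕ H ⊕ G`. -/
abbrev hhVec (a b c d : ℤ) (z : G) : (Fin 2 → ℤ) × (Fin 2 → ℤ) × G := (![a, b], ![c, d], z)

/-- The lattice `H ⊕ H ⊕ B`. -/
abbrev hhSum (B : Bil G) : Bil ((Fin 2 → ℤ) × (Fin 2 → ℤ) × G) :=
  prodForm HForm (prodForm HForm B)

lemma hhSum_apply (B : Bil G) (a b c d : ℤ) (z : G) (a' b' c' d' : ℤ) (z' : G) :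
    hhSum B (hhVec a b c d z) (hhVec a' b' c' d' z') =
      a * b' + b * a' + (c * d' + d * c' + B z z') := rfl

lemma exists_eq_hhVec {G : Type} (v : (Fin 2 → ℤ) × (Fin 2 → ℤ) × G) :
    ∃ a b c d z, v = hhVec a b c d z :=
  ⟨v.1 0, v.1 1, v.2.1 0, v.2.1 1, v.2.2, by
    refine Prod.ext ?_ (Prod.ext ?_ rfl) <;> ext i <;> fin_cases i <;> rfl⟩

/-- `v` and `w` lie in the same orbit of the isometry group. -/
def SameOrbit (B : Bil G) (v w : G) : Prop := ∃ σ, IsIsometry B σ ∧ σ v = w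

lemma SameOrbit.trans {B : Bil G} {u v w : G} (h : SameOrbit B u v) (h' : SameOrbit B v w) :
    SameOrbit B u w := by
  obtain ⟨σ, hσ, rfl⟩ := h
  obtain ⟨τ, hτ, rfl⟩ := h'
  exact ⟨σ.trans τ, hσ.trans hτ, rfl⟩

lemma sameOrbit_neg (B : Bil G) (v : G) : SameOrbit B v (-v) :=
  ⟨LinearEquiv.neg ℤ, fun u v => by simp, rfl⟩

variable (B : Bil G) (a b c d : ℤ) (z : G)

lemma sameOrbit_swap : SameOrbit (hhSum B) (hhVec a b c d z) (hhVec b a c d z) := by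
  refine ⟨(LinearEquiv.funCongrLeft ℤ ℤ (Equiv.swap 0 1)).prodCongr (LinearEquiv.refl ℤ _),
    IsIsometry.prod (fun u v => ?_) (isIsometry_refl _), ?_⟩
  · simp [HForm_apply, LinearMap.funLeft_apply]; ring
  · refine Prod.ext ?_ rfl
    ext i; fin_cases i <;> simp [LinearMap.funLeft_apply]

lemma sameOrbit_swap_planes : SameOrbit (hhSum B) (hhVec a b c d z) (hhVec c d a b z) := by
  let τ : ((Fin 2 → ℤ) × (Fin 2 → ℤ) × G) ≃ₗ[ℤ] ((Fin 2 → ℤ) × (Fin 2 → ℤ) × G) :=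
    { toFun := fun u => (u.2.1, u.1, u.2.2)
      invFun := fun u => (u.2.1, u.1, u.2.2)
      map_add' := fun _ _ => rfl
      map_smul' := fun _ _ => rfl }
  exact ⟨τ, fun u v => add_left_comm (HForm u.2.1 v.2.1) (HForm u.1 v.1) (B u.2.2 v.2.2), rfl⟩

variable {B}

lemma sameOrbit_shear (hB : SymmForm B) (t : ℤ) :
    SameOrbit (hhSum B) (hhVec a b c d z) (hhVec (a - t * d) b (c + t * b) d z) := by
  have hS : SymmForm (hhSum B) := symmForm_HForm.prod (symmForm_HForm.prod hB)
  have he : hhSum B (hhVec 1 0 0 0 0) (hhVec 1 0 0 0 0) = 0 := by simp [hhSum_apply]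
  have hey : hhSum B (hhVec 1 0 0 0 0) (hhVec 0 0 t 0 0) = 0 := by simp [hhSum_apply]
  have hy : hhSum B (hhVec 0 0 t 0 0) (hhVec 0 0 t 0 0) = 2 * 0 := by simp [hhSum_apply]
  refine ⟨eichler hS he hey hy, isIsometry_eichler hS he hey hy, ?_⟩
  rw [eichler_apply, hhSum_apply, hhSum_apply]
  refine Prod.ext ?_ (Prod.ext ?_ ?_)
  · ext i; fin_cases i <;> simp
  · ext i; fin_cases i <;> simp [mul_comm]
  · simp

lemma sameOrbit_transvection (hB : SymmForm B) {y : G} {q : ℤ} (hq : B y y = 2 * q) :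
    SameOrbit (hhSum B) (hhVec a b c d z) (hhVec (a - B y z - q * b) b c d (z + b • y)) := by
  have hS : SymmForm (hhSum B) := symmForm_HForm.prod (symmForm_HForm.prod hB)
  have he : hhSum B (hhVec 1 0 0 0 0) (hhVec 1 0 0 0 0) = 0 := by simp [hhSum_apply]
  have hey : hhSum B (hhVec 1 0 0 0 0) (hhVec 0 0 0 0 y) = 0 := by simp [hhSum_apply]
  have hy : hhSum B (hhVec 0 0 0 0 y) (hhVec 0 0 0 0 y) = 2 * q := by simp [hhSum_apply, hq]
  refine ⟨eichler hS he hey hy, isIsometry_eichler hS he hey hy, ?_⟩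
  rw [eichler_apply, hhSum_apply, hhSum_apply]
  refine Prod.ext ?_ (Prod.ext ?_ ?_)
  · ext i; fin_cases i <;> simp
  · ext i; fin_cases i <;> simp
  · simp

/-- An isotropic vector of `H ⊕ H ⊕ B` (with `B` even) pairing to `1` with some vector lies in the
orbit of the standard isotropic vector. -/
lemma sameOrbit_std (hB : SymmForm B) (hE : EvenForm B) {v w : (Fin 2 → ℤ) × (Fin 2 → ℤ) × G}
    (hv : hhSum B v v = 0) (hvw : hhSum B v w = 1) :
    SameOrbit (hhSum B) v (hhVec 1 0 0 0 0) := by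
  classical
  let P : ℕ → Prop := fun n => n ≠ 0 ∧
    ∃ a b c d z, SameOrbit (hhSum B) v (hhVec a b c d z) ∧ a.natAbs = n
  have hP : ∃ n, P n := by
    obtain ⟨a, b, c, d, z, rfl⟩ := exists_eq_hhVec v
    obtain ⟨a', b', c', d', z', rfl⟩ := exists_eq_hhVec w
    by_cases ha : a = 0
    · by_cases hb : b = 0
      · by_cases hc : c = 0
        · by_cases hd : d = 0
          · subst ha hb hc hd
            obtain ⟨q, hq⟩ := hE z'
            refine ⟨_, ?_, _, _, _, _, _, sameOrbit_transvection _ _ _ _ _ hB hq, rfl⟩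
            have : B z' z = 1 := by
              rw [hB]; simpa [hhSum_apply] using hvw
            simp [this]
          · exact ⟨d.natAbs, by simpa using hd, _, _, _, _, _,
              (sameOrbit_swap_planes B a b c d z).trans (sameOrbit_swap B _ _ _ _ _), rfl⟩
        · exact ⟨c.natAbs, by simpa using hc, _, _, _, _, _, sameOrbit_swap_planes B a b c d z, rfl⟩
      · exact ⟨b.natAbs, by simpa using hb, _, _, _, _, _, sameOrbit_swap B a b c d z, rfl⟩
    · exact ⟨a.natAbs, by simpa using ha, _, _, _, _, _, ⟨_, isIsometry_refl _, rfl⟩, rfl⟩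
  obtain ⟨hn, a, b, c, d, z, hO, han⟩ := Nat.find_spec hP
  have ha : a ≠ 0 := by
    rintro rfl; exact hn han.symm
  have hmin : ∀ a' b' c' d' z', SameOrbit (hhSum B) v (hhVec a' b' c' d' z') →
      a'.natAbs < a.natAbs → a' = 0 := by
    intro a' b' c' d' z' h hlt
    by_contra h0
    exact Nat.find_min hP (han ▸ hlt) ⟨by simpa using h0, _, _, _, _, _, h, rfl⟩
  have hshear : ∀ {b c d z} (t : ℤ), SameOrbit (hhSum B) v (hhVec a b c d z) →
      SameOrbit (hhSum B) v (hhVec a (b - t * d) (c + t * a) d z) := fun t h =>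
    ((h.trans (sameOrbit_swap B _ _ _ _ _)).trans (sameOrbit_shear _ _ _ _ _ hB t)).trans
      (sameOrbit_swap B _ _ _ _ _)
  have hdvd : ∀ {b c d z}, SameOrbit (hhSum B) v (hhVec a b c d z) → a ∣ c := by
    intro b c d z h
    have h' := (hshear (-(c / a)) h).trans (sameOrbit_swap_planes B _ _ _ _ _)
    have hr : c + -(c / a) * a = c % a := by
      linarith [Int.emod_add_mul_ediv c a, mul_comm a (c / a)]
    rw [hr] at h'
    refine Int.dvd_of_emod_eq_zero (hmin _ _ _ _ _ h' ?_)
    have h1 := Int.emod_nonneg c ha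
    have h2 := Int.emod_lt c ha
    omega
  have hclear : ∀ {b c d z}, SameOrbit (hhSum B) v (hhVec a b c d z) →
      ∃ b', SameOrbit (hhSum B) v (hhVec a b' 0 d z) := by
    intro b c d z h
    obtain ⟨k, rfl⟩ := hdvd h
    have h' := hshear (-k) h
    rw [show a * k + -k * a = 0 by ring] at h'
    exact ⟨_, h'⟩
  obtain ⟨b₁, h₁⟩ := hclear hO
  obtain ⟨b₂, h₂⟩ := hclear (((h₁.trans (sameOrbit_swap_planes B _ _ _ _ _)).trans
    (sameOrbit_swap B _ _ _ _ _)).trans (sameOrbit_swap_planes B _ _ _ _ _))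
  have hab : a ∣ b₂ := by
    have h := h₂.trans (sameOrbit_shear _ _ _ _ _ hB 1)
    rw [mul_zero, sub_zero] at h
    simpa using hdvd h
  have haz : ∀ y, a ∣ B z y := by
    intro y
    obtain ⟨q, hq⟩ := hE y
    have h := ((h₂.trans (sameOrbit_swap_planes B _ _ _ _ _)).trans
      (sameOrbit_transvection _ _ _ _ _ hB hq)).trans (sameOrbit_swap_planes B _ _ _ _ _)
    rw [hB]
    simpa using hdvd h
  have ha1 : a ∣ 1 := by
    obtain ⟨σ, hσ, hσv⟩ := h₂
    obtain ⟨a', b', c', d', z', hw⟩ := exists_eq_hhVec (σ w)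
    rw [← hσ, hσv, hw, hhSum_apply] at hvw
    rw [← hvw]
    simpa using (dvd_add ((dvd_mul_right a b').add (hab.mul_right a')) (haz z'))
  obtain ⟨b₃, z₃, h₃⟩ : ∃ b z, SameOrbit (hhSum B) v (hhVec 1 b 0 0 z) := by
    rcases Int.isUnit_iff.1 (isUnit_of_dvd_one ha1) with rfl | rfl
    · exact ⟨_, _, h₂⟩
    · exact ⟨-b₂, -z, by simpa [hhVec] using h₂.trans (sameOrbit_neg _ _)⟩
  obtain ⟨q, hq⟩ := hE (-z₃)
  have h₄ := ((h₃.trans (sameOrbit_swap B _ _ _ _ _)).trans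
    (sameOrbit_transvection _ _ _ _ _ hB hq)).trans (sameOrbit_swap B _ _ _ _ _)
  rw [one_smul, add_neg_cancel] at h₄
  have h₅ := h₄
  obtain ⟨σ, hσ, hσv⟩ := h₅
  rw [← hσ, hσv, hhSum_apply] at hv
  simp only [map_zero, mul_zero, add_zero, one_mul, mul_one] at hv
  rwa [show b₃ - B (-z₃) z₃ - q * 1 = 0 by linarith] at h₄

lemma exists_isometry_std_pair (hB : SymmForm B) (hE : EvenForm B)
    {e f : (Fin 2 → ℤ) × (Fin 2 → ℤ) × G} (he : hhSum B e e = 0) (hf : hhSum B f f = 0)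
    (hef : hhSum B e f = 1) : ∃ σ, IsIsometry (hhSum B) σ ∧ σ e = hhVec 1 0 0 0 0 ∧
      σ f = hhVec 0 1 0 0 0 := by
  obtain ⟨σ, hσ, hσe⟩ := sameOrbit_std hB hE he hef
  have hS : SymmForm (hhSum B) := symmForm_HForm.prod (symmForm_HForm.prod hB)
  obtain ⟨τ, hτ, hτe, hτf⟩ := exists_isometry_fix hS (e := hhVec 1 0 0 0 0) (f := σ f)
    (f' := hhVec 0 1 0 0 0) (by simp [hhSum_apply]) (by rw [hσ, hf]) (by simp [hhSum_apply])
    (by rw [← hσe, hσ, hef]) (by simp [hhSum_apply])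
  exact ⟨σ.trans τ, hσ.trans hτ, by simp [hσe, hτe], by simp [hτf]⟩

lemma HForm_eq_zero {p : Fin 2 → ℤ} (h : ∀ u, HForm u p = 0) : p = 0 := by
  have h0 := h ![0, 1]
  have h1 := h ![1, 0]
  simp only [HForm_apply, Matrix.cons_val_zero, Matrix.cons_val_one] at h0 h1
  ext i; fin_cases i <;> simp <;> linarith

/-- Any isometric embedding of `H ⊕ H` in `H ⊕ H ⊕ (H ⊕ B)`, with `B` even, is carried to the
standard one by an isometry. -/
lemma exists_isometry_std_embedding (hB : SymmForm B) (hE : EvenForm B)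
    (φ : HHtype →ₗ[ℤ] (Fin 2 → ℤ) × (Fin 2 → ℤ) × (Fin 2 → ℤ) × G)
    (hφ : ∀ u v, hhSum (prodForm HForm B) (φ u) (φ v) = HHForm u v) :
    ∃ σ, IsIsometry (hhSum (prodForm HForm B)) σ ∧ ∀ u, σ (φ u) = (u.1, u.2, 0) := by
  have hHH : ∀ u v : HHtype, HHForm u v = HForm u.1 v.1 + HForm u.2 v.2 := fun _ _ => rfl
  obtain ⟨σ, hσ, he, hf⟩ := exists_isometry_std_pair (e := φ (![1, 0], 0)) (f := φ (![0, 1], 0))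
    (symmForm_HForm.prod hB) (evenForm_HForm.prod hE) (by rw [hφ, hHH]; simp [HForm_apply])
    (by rw [hφ, hHH]; simp [HForm_apply]) (by rw [hφ, hHH]; simp [HForm_apply])
  have hperp : ∀ w, (σ (φ (0, w))).1 = 0 := by
    intro w
    have h1 : hhSum (prodForm HForm B) (σ (φ (![1, 0], 0))) (σ (φ (0, w))) = 0 := by
      rw [hσ, hφ, hHH]; simp
    have h2 : hhSum (prodForm HForm B) (σ (φ (![0, 1], 0))) (σ (φ (0, w))) = 0 := by
      rw [hσ, hφ, hHH]; simp
    rw [he] at h1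
    rw [hf] at h2
    simp [prodForm_apply, HForm_apply] at h1 h2
    ext i; fin_cases i <;> simp [h1, h2]
  have hform : ∀ u v, hhSum B (σ (φ (0, u))).2 (σ (φ (0, v))).2 = HForm u v := by
    intro u v
    have h : hhSum (prodForm HForm B) (σ (φ (0, u))) (σ (φ (0, v))) = HForm u v := by
      rw [hσ, hφ, hHH]; simp
    rw [prodForm_apply, hperp u] at h
    simpa using h
  obtain ⟨τ, hτ, he', hf'⟩ := exists_isometry_std_pair (e := (σ (φ (0, ![1, 0]))).2)
    (f := (σ (φ (0, ![0, 1]))).2) hB hE (by rw [hform]; simp [HForm_apply])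
    (by rw [hform]; simp [HForm_apply]) (by rw [hform]; simp [HForm_apply])
  have hz : ((![0, 0], 0) : (Fin 2 → ℤ) × (Fin 2 → ℤ) × G) = 0 := by
    refine Prod.ext ?_ rfl
    ext i; fin_cases i <;> rfl
  refine ⟨σ.trans ((LinearEquiv.refl ℤ _).prodCongr τ),
    hσ.trans ((isIsometry_refl _).prod hτ), fun u => ?_⟩
  have hu : u = u.1 0 • (![1, 0], 0) + u.1 1 • (![0, 1], 0) + u.2 0 • (0, ![1, 0]) +
      u.2 1 • (0, ![0, 1]) := by
    refine Prod.ext ?_ ?_ <;> ext i <;> fin_cases i <;> simp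
  conv_lhs => rw [hu]
  simp only [map_add, map_smul, LinearEquiv.trans_apply, he, hf]
  refine Prod.ext ?_ (Prod.ext ?_ ?_)
  · ext i; fin_cases i <;> simp [hperp]
  · ext i; fin_cases i <;> simp [he', hf', hz]
  · simp [he', hf', hz]

end Hyperbolic
section E8

/-- The inverse of `E8Gram`. -/
def E8GramInv : Matrix (Fin 8) (Fin 8) ℤ :=
  !![-4, -5, -7, -10, -8, -6, -4, -2;
    -5, -8, -10, -15, -12, -9, -6, -3;
    -7, -10, -14, -20, -16, -12, -8, -4;
    -10, -15, -20, -30, -24, -18, -12, -6;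
    -8, -12, -16, -24, -20, -15, -10, -5;
    -6, -9, -12, -18, -15, -12, -8, -4;
    -4, -6, -8, -12, -10, -8, -6, -3;
    -2, -3, -4, -6, -5, -4, -3, -2]

lemma E8GramInv_mul_E8Gram : E8GramInv * E8Gram = 1 := by
  decide +kernel

lemma E8Form_apply (x y : Fin 8 → ℤ) : E8Form x y = x ⬝ᵥ E8Gram.mulVec y :=
  Matrix.toLinearMap₂'_apply' _ _ _

lemma symmForm_E8Form : SymmForm E8Form := fun x y => by
  have h : E8Gram.transpose = E8Gram := by decide +kernel
  rw [E8Form_apply, E8Form_apply, Matrix.dotProduct_mulVec, ← Matrix.mulVec_transpose, h,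
    dotProduct_comm]

lemma evenForm_E8Form : EvenForm E8Form := fun x => by
  refine ⟨-(x 0 ^ 2 + x 1 ^ 2 + x 2 ^ 2 + x 3 ^ 2 + x 4 ^ 2 + x 5 ^ 2 + x 6 ^ 2 + x 7 ^ 2) +
    x 0 * x 2 + x 1 * x 3 + x 2 * x 3 + x 3 * x 4 + x 4 * x 5 + x 5 * x 6 + x 6 * x 7, ?_⟩
  rw [E8Form_apply]
  simp [E8Gram, dotProduct, Matrix.mulVec, Fin.sum_univ_succ]
  ring

lemma unimodular_E8Form : Unimodular E8Form := fun φ => by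
  let c : Fin 8 → ℤ := fun i => φ (Pi.single i 1)
  refine ⟨Matrix.vecMul c E8GramInv, fun y => ?_⟩
  rw [E8Form_apply, Matrix.dotProduct_mulVec, Matrix.vecMul_vecMul, E8GramInv_mul_E8Gram,
    Matrix.vecMul_one]
  conv_rhs => rw [pi_eq_sum_univ' y]
  simp only [map_sum, map_smul, smul_eq_mul, dotProduct, c, mul_comm]

end E8

section Sublattices

variable {G G' : Type} [AddCommGroup G] [AddCommGroup G'] {B : Bil G} {B' : Bil G'}

lemma mem_perpSub {S : Submodule ℤ G} (hB : SymmForm B) {v : G} :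
    v ∈ perpSub B S ↔ ∀ s ∈ S, B s v = 0 :=
  ⟨fun h s hs => (h s hs).1, fun h s hs => ⟨h s hs, by rw [hB, h s hs]⟩⟩

lemma primSub_perpSub (hB : SymmForm B) (S : Submodule ℤ G) : PrimSub (perpSub B S) := by
  intro n x hn hx
  rw [mem_perpSub hB] at hx ⊢
  intro s hs
  simpa [hn] using hx s hs

lemma isometricTo_range {φ : G' →ₗ[ℤ] G} (hφ : ∀ u v, B (φ u) (φ v) = B' u v)
    (hinj : Function.Injective φ) : IsometricTo B (LinearMap.range φ) B' :=
  ⟨LinearEquiv.ofInjective φ hinj, fun u v => by simp [hφ]⟩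

lemma IsometricTo.exists_eq_range {N : Submodule ℤ G} (h : IsometricTo B N B') :
    ∃ φ : G' →ₗ[ℤ] G, N = LinearMap.range φ ∧ ∀ u v, B (φ u) (φ v) = B' u v := by
  obtain ⟨e, he⟩ := h
  refine ⟨N.subtype ∘ₗ e.toLinearMap, ?_, he⟩
  rw [LinearMap.range_comp, LinearEquiv.range, Submodule.map_top, Submodule.range_subtype]

/-- Orthogonal projection onto a unimodular sublattice. -/
lemma exists_proj (hB : SymmForm B) (hB' : SymmForm B') (hU : Unimodular B') {φ : G' →ₗ[ℤ] G}
    (hφ : ∀ u v, B (φ u) (φ v) = B' u v) (x : G) :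
    ∃ p ∈ LinearMap.range φ, ∀ y ∈ LinearMap.range φ, B y p = B y x := by
  obtain ⟨u, hu⟩ := hU (B x ∘ₗ φ)
  refine ⟨φ u, ⟨u, rfl⟩, ?_⟩
  rintro _ ⟨v, rfl⟩
  rw [hφ, hB', hu, hB _ x, LinearMap.comp_apply]

lemma PrimSub.exists_retraction [Module.Finite ℤ G] {I : Submodule ℤ G} (hI : PrimSub I) :
    ∃ r : G →ₗ[ℤ] I, ∀ x : I, r x = x := by
  have : Module.IsTorsionFree ℤ (G ⧸ I) := by
    rw [Module.isTorsionFree_iff_smul_eq_zero]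
    intro n x h
    induction x using Submodule.Quotient.induction_on with | _ x =>
    rw [← Submodule.Quotient.mk_smul, Submodule.Quotient.mk_eq_zero] at h
    rw [Submodule.Quotient.mk_eq_zero]
    exact or_iff_not_imp_left.2 fun hn => hI n x hn h
  obtain ⟨s, hs⟩ := Module.projective_lifting_property I.mkQ LinearMap.id I.mkQ_surjective
  let p : G →ₗ[ℤ] G := LinearMap.id - s ∘ₗ I.mkQ
  have hp : ∀ x, p x = x - s (I.mkQ x) := fun _ => rfl
  have hmem : ∀ x, p x ∈ I := fun x => by
    rw [← Submodule.Quotient.mk_eq_zero]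
    have := LinearMap.congr_fun hs (I.mkQ x)
    simp only [LinearMap.comp_apply, LinearMap.id_apply, Submodule.mkQ_apply] at this
    simp [hp, this]
  refine ⟨p.codRestrict I hmem, fun x => Subtype.ext ?_⟩
  rw [LinearMap.codRestrict_apply, hp, Submodule.mkQ_apply, (Submodule.Quotient.mk_eq_zero I).2 x.2,
    map_zero, sub_zero]

/-- A primitive isotropic sublattice of rank two of an even unimodular lattice is doubly admissible
in any `S` into which vectors project without changing their pairings with it. -/
lemma doublyAdm_of_proj [Module.Finite ℤ G] [Module.Free ℤ G] (hB : SymmForm B)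
    (hE : EvenForm B) (hU : Unimodular B) {S I : Submodule ℤ G} (hIS : I ≤ S) (hI : PrimSub I)
    (hiso : IsotropicSub B I) (hrk : Module.finrank ℤ I = 2)
    (hproj : ∀ x, ∃ y ∈ S, ∀ e ∈ I, B e y = B e x) : DoublyAdm B S I := by
  obtain ⟨r, hr⟩ := hI.exists_retraction
  let b := Module.finBasisOfFinrankEq ℤ I hrk
  have hdual : ∀ i, ∃ g ∈ S, B g g = 0 ∧ ∀ j, B (b j) g = if j = i then 1 else 0 := by
    intro i
    obtain ⟨x, hx⟩ := hU (b.coord i ∘ₗ r)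
    obtain ⟨y, hyS, hy⟩ := hproj x
    obtain ⟨q, hq⟩ := hE y
    have hby : ∀ j, B (b j) y = if j = i then 1 else 0 := fun j => by
      rw [hy _ (b j).2, hB, hx, LinearMap.comp_apply, hr]
      simp [Finsupp.single_apply]
    have hbb : ∀ j, B (b j) (b i) = 0 := fun j => hiso _ (b j).2 _ (b i).2
    refine ⟨y - q • (b i : G), S.sub_mem hyS (S.smul_mem _ (hIS (b i).2)), ?_, fun j => ?_⟩
    · simp [hbb, hB y, hby, hq]; ring
    · simp [hbb, hby]
  obtain ⟨g₁, hg₁, h₁, hb₁⟩ := hdual 0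
  obtain ⟨g₂, hg₂, h₂, hb₂⟩ := hdual 1
  have hprim : ∀ (e g : G), B e g = 1 → PrimEltIn S e := by
    rintro _ g h n x - rfl
    exact IsUnit.of_mul_eq_one (B x g) (by simpa using h)
  have e₁ : B (b 0) g₁ = 1 := by simp [hb₁]
  have e₂ : B (b 1) g₂ = 1 := by simp [hb₂]
  refine ⟨b 0, b 1, g₁, g₂, hIS (b 0).2, hIS (b 1).2, hg₁, hg₂, hprim _ _ e₁, hprim _ _ e₂, ?_,
    h₁, h₂, e₁, e₂, by simp [hb₂], by simp [hb₁]⟩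
  have := congrArg (Submodule.map I.subtype) b.span_eq
  rw [Submodule.map_top, Submodule.range_subtype, Submodule.map_span, ← Set.range_comp] at this
  refine this.symm.trans (congrArg _ ?_)
  ext x
  simp [Fin.exists_fin_two, eq_comm]

/-- The span of two dual pairs of isotropic classes is an embedded `H ⊕ H`. -/
lemma DoublyAdm.exists_embedding (hB : SymmForm B) {S I : Submodule ℤ G}
    (hiso : IsotropicSub B I) (h : DoublyAdm B S I) :
    ∃ φ : HHtype →ₗ[ℤ] G, (∀ u v, B (φ u) (φ v) = HHForm u v) ∧
      I ≤ LinearMap.range φ ∧ LinearMap.range φ ≤ S := by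
  obtain ⟨e₁, e₂, g₁, g₂, he₁, he₂, hg₁, hg₂, -, -, rfl, h₁, h₂, h₁₁, h₂₂, h₁₂, h₂₁⟩ := h
  have m₁ : e₁ ∈ Submodule.span ℤ {e₁, e₂} := Submodule.subset_span (by simp)
  have m₂ : e₂ ∈ Submodule.span ℤ {e₁, e₂} := Submodule.subset_span (by simp)
  let g : G := g₂ - B g₁ g₂ • e₁
  let x : Fin 2 → HHtype →ₗ[ℤ] ℤ := fun i => LinearMap.proj i ∘ₗ LinearMap.fst ℤ _ _
  let y : Fin 2 → HHtype →ₗ[ℤ] ℤ := fun i => LinearMap.proj i ∘ₗ LinearMap.snd ℤ _ _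
  let φ : HHtype →ₗ[ℤ] G := (x 0).smulRight e₁ + (x 1).smulRight g₁ + (y 0).smulRight e₂ +
    (y 1).smulRight g
  have hφ : ∀ u, φ u = u.1 0 • e₁ + u.1 1 • g₁ + u.2 0 • e₂ + u.2 1 • g := fun _ => rfl
  refine ⟨φ, fun u v => ?_, ?_, ?_⟩
  · rw [hφ, hφ]
    change _ = (u.1 0 * v.1 1 + u.1 1 * v.1 0) + (u.2 0 * v.2 1 + u.2 1 * v.2 0)
    simp only [g, map_add, map_sub, map_smul, LinearMap.add_apply, LinearMap.sub_apply,
      LinearMap.smul_apply, smul_eq_mul, hiso _ m₁ _ m₁, hiso _ m₁ _ m₂, hiso _ m₂ _ m₁,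
      hiso _ m₂ _ m₂, hB g₁ e₁, hB g₁ e₂, hB g₂ e₁, hB g₂ e₂, hB g₂ g₁, h₁, h₂, h₁₁, h₂₂, h₁₂, h₂₁]
    ring
  · rw [Submodule.span_le]
    rintro _ (rfl | rfl)
    · exact ⟨(![1, 0], 0), by simp [hφ]⟩
    · exact ⟨(0, ![1, 0]), by simp [hφ]⟩
  · rintro _ ⟨u, rfl⟩
    rw [hφ]
    exact S.add_mem (S.add_mem (S.add_mem (S.smul_mem _ he₁) (S.smul_mem _ hg₁))
      (S.smul_mem _ he₂)) (S.smul_mem _ (S.sub_mem hg₂ (S.smul_mem _ he₁)))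

lemma HHForm_eq_zero {p : HHtype} (h : ∀ u, HHForm u p = 0) : p = 0 := by
  refine Prod.ext (HForm_eq_zero fun u => ?_) (HForm_eq_zero fun u => ?_)
  · simpa [HHForm, prodForm_apply] using h (u, 0)
  · simpa [HHForm, prodForm_apply] using h (0, u)

lemma symmForm_HHForm : SymmForm HHForm := symmForm_HForm.prod symmForm_HForm

lemma unimodular_HHForm : Unimodular HHForm := unimodular_HForm.prod unimodular_HForm

lemma injective_of_isometric_HHForm {φ : HHtype →ₗ[ℤ] G}
    (hφ : ∀ u v, B (φ u) (φ v) = HHForm u v) : Function.Injective φ := by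
  rw [injective_iff_map_eq_zero]
  intro u hu
  exact HHForm_eq_zero fun v => by rw [← hφ, hu, map_zero]

lemma primSub_range_of_isometric_HHForm [Module.IsTorsionFree ℤ G] (hB : SymmForm B)
    {φ : HHtype →ₗ[ℤ] G} (hφ : ∀ u v, B (φ u) (φ v) = HHForm u v) :
    PrimSub (LinearMap.range φ) := by
  rintro n x hn ⟨w, hw⟩
  obtain ⟨_, ⟨u, rfl⟩, hu⟩ := exists_proj hB symmForm_HHForm unimodular_HHForm hφ x
  have h0 : w - n • u = 0 := HHForm_eq_zero fun v => by
    rw [← hφ, map_sub, map_smul, hw, map_sub, map_smul, map_smul, hu _ ⟨v, rfl⟩, sub_self]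
  have h1 : n • φ u = n • x := by
    rw [← hw, ← map_smul, sub_eq_zero.1 h0]
  exact ⟨u, smul_right_injective G hn h1⟩

end Sublattices

section K3

lemma symmForm_EE : SymmForm (prodForm E8Form E8Form) := symmForm_E8Form.prod symmForm_E8Form

lemma evenForm_EE : EvenForm (prodForm E8Form E8Form) := evenForm_E8Form.prod evenForm_E8Form

lemma symmForm_HEEForm : SymmForm HEEForm := symmForm_HForm.prod symmForm_EE

lemma unimodular_HEEForm : Unimodular HEEForm :=
  unimodular_HForm.prod (unimodular_E8Form.prod unimodular_E8Form)

lemma symmForm_K3Form : SymmForm K3Form :=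
  symmForm_HForm.prod (symmForm_HForm.prod symmForm_HEEForm)

lemma evenForm_K3Form : EvenForm K3Form :=
  evenForm_HForm.prod (evenForm_HForm.prod (evenForm_HForm.prod evenForm_EE))

lemma unimodular_K3Form : Unimodular K3Form :=
  unimodular_HForm.prod (unimodular_HForm.prod unimodular_HEEForm)

/-- The orthogonal complement of any embedded `H ⊕ H` in the K3 lattice is `H ⊕ E₈ ⊕ E₈`. -/
lemma isometricTo_perpSub_range {φ : HHtype →ₗ[ℤ] K3type}
    (hφ : ∀ u v, K3Form (φ u) (φ v) = HHForm u v) :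
    IsometricTo K3Form (perpSub K3Form (LinearMap.range φ)) HEEForm := by
  obtain ⟨σ, hσ, hσφ⟩ : ∃ σ, IsIsometry K3Form σ ∧ ∀ u, σ (φ u) = (u.1, u.2, 0) :=
    exists_isometry_std_embedding symmForm_EE evenForm_EE φ hφ
  let ι : HEEtype →ₗ[ℤ] K3type := LinearMap.inr ℤ _ _ ∘ₗ LinearMap.inr ℤ _ _
  have hK3 : ∀ (p q : Fin 2 → ℤ) (n : HEEtype) (p' q' : Fin 2 → ℤ) (n' : HEEtype),
      K3Form (p, q, n) (p', q', n') = HForm p p' + (HForm q q' + HEEForm n n') :=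
    fun _ _ _ _ _ _ => rfl
  have hι : ∀ n, ι n = (0, 0, n) := fun _ => rfl
  let ψ : HEEtype →ₗ[ℤ] K3type := σ.symm.toLinearMap ∘ₗ ι
  have hψ : ∀ n, ψ n = σ.symm (0, 0, n) := fun _ => rfl
  have hrange : perpSub K3Form (LinearMap.range φ) = LinearMap.range ψ := by
    ext v
    rw [mem_perpSub symmForm_K3Form]
    constructor
    · intro h
      obtain ⟨p, q, n, hv⟩ : ∃ p q n, σ v = (p, q, n) := ⟨_, _, _, rfl⟩
      have h0 : ((p, q) : HHtype) = 0 := HHForm_eq_zero fun u => by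
        have := h _ ⟨u, rfl⟩
        rw [← hσ, hσφ, hv, hK3] at this
        simpa [HHForm, prodForm_apply] using this
      obtain ⟨rfl, rfl⟩ := Prod.mk_eq_zero.1 h0
      exact ⟨n, by rw [hψ, ← hv, LinearEquiv.symm_apply_apply]⟩
    · rintro ⟨n, rfl⟩ _ ⟨u, rfl⟩
      rw [← hσ, hσφ, hψ, LinearEquiv.apply_symm_apply, hK3]
      simp
  rw [hrange]
  refine isometricTo_range (fun u v => ?_) (σ.symm.injective.comp fun u v h => ?_)
  · rw [hψ, hψ, hσ.symm, hK3]
    simp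
  · simpa [hι] using h

end K3

end DF

open DF in
/-- Let `L` be a nondegenerate primitive sublattice of the K3
lattice `Λ_K3` and let `I` be a primitive rank-2 isotropic sublattice of `L^⊥`.
The following are equivalent:
(1) `I` is doubly admissible in `L^⊥`;
(2) the inclusion `I ↪ L^⊥` factors through primitive embeddings
    `I ↪ M ↪ L^⊥` with `M` isometric to `H ⊕ H`;
(3) the inclusion `L ↪ I^⊥` factors through primitive embeddings
    `L ↪ N ↪ I^⊥` with `N` isometric to `H ⊕ E₈ ⊕ E₈`. -/
theorem stmt14 (L : Submodule ℤ K3type) (hLnd : NondegOn K3Form L) (hLprim : PrimSub L)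
    (I : Submodule ℤ K3type) (hIle : I ≤ perpSub K3Form L)
    (hIprim : PrimIn I (perpSub K3Form L)) (hIiso : IsotropicSub K3Form I)
    (hIrk : Module.finrank ℤ ↥I = 2) :
    (DoublyAdm K3Form (perpSub K3Form L) I ↔
      (∃ M : Submodule ℤ K3type, I ≤ M ∧ M ≤ perpSub K3Form L ∧
        PrimIn I M ∧ PrimIn M (perpSub K3Form L) ∧
        IsometricTo K3Form M HHForm)) ∧
    ((∃ M : Submodule ℤ K3type, I ≤ M ∧ M ≤ perpSub K3Form L ∧
        PrimIn I M ∧ PrimIn M (perpSub K3Form L) ∧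
        IsometricTo K3Form M HHForm) ↔
      (∃ N : Submodule ℤ K3type, L ≤ N ∧ N ≤ perpSub K3Form I ∧
        PrimIn L N ∧ PrimIn N (perpSub K3Form I) ∧
        IsometricTo K3Form N HEEForm)) := by
  have hsymm := symmForm_K3Form
  have hI : PrimSub I := fun n x hn hx =>
    hIprim n x hn (primSub_perpSub hsymm L n x hn (hIle hx)) hx
  have hadm := doublyAdm_of_proj hsymm evenForm_K3Form unimodular_K3Form hIle hI hIiso hIrk
  have h21 : (∃ M : Submodule ℤ K3type, I ≤ M ∧ M ≤ perpSub K3Form L ∧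
      PrimIn I M ∧ PrimIn M (perpSub K3Form L) ∧ IsometricTo K3Form M HHForm) →
      DoublyAdm K3Form (perpSub K3Form L) I := by
    rintro ⟨M, hIM, hML, -, -, hM⟩
    obtain ⟨φ, rfl, hφ⟩ := hM.exists_eq_range
    refine hadm fun x => ?_
    obtain ⟨p, hp, hpx⟩ := exists_proj hsymm symmForm_HHForm unimodular_HHForm hφ x
    exact ⟨p, hML hp, fun e he => hpx e (hIM he)⟩
  have h12 : DoublyAdm K3Form (perpSub K3Form L) I →
      ∃ M : Submodule ℤ K3type, I ≤ M ∧ M ≤ perpSub K3Form L ∧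
      PrimIn I M ∧ PrimIn M (perpSub K3Form L) ∧ IsometricTo K3Form M HHForm := by
    intro h
    obtain ⟨φ, hφ, hIφ, hφL⟩ := h.exists_embedding hsymm hIiso
    exact ⟨_, hIφ, hφL, fun n x hn _ hx => hI n x hn hx,
      fun n x hn _ hx => primSub_range_of_isometric_HHForm hsymm hφ n x hn hx,
      isometricTo_range hφ (injective_of_isometric_HHForm hφ)⟩
  refine ⟨⟨h12, h21⟩, ?_, fun h => h12 ?_⟩
  · rintro ⟨M, hIM, hML, -, -, hM⟩
    obtain ⟨φ, rfl, hφ⟩ := hM.exists_eq_range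
    refine ⟨perpSub K3Form (LinearMap.range φ), fun l hl => ?_, fun v hv s hs => hv s (hIM hs),
      fun n x hn _ hx => hLprim n x hn hx,
      fun n x hn _ hx => primSub_perpSub hsymm _ n x hn hx, isometricTo_perpSub_range hφ⟩
    exact fun m hm => (hML hm l hl).symm
  · obtain ⟨N, hLN, hNI, -, -, hN⟩ := h
    obtain ⟨φ, rfl, hφ⟩ := hN.exists_eq_range
    refine hadm fun x => ?_
    obtain ⟨p, hp, hpx⟩ := exists_proj hsymm symmForm_HEEForm unimodular_HEEForm hφ x
    refine ⟨x - p, (mem_perpSub hsymm).2 fun l hl => ?_, fun e he => ?_⟩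
    · rw [map_sub, hpx l (hLN hl), sub_self]
    · rw [map_sub, (hNI hp e he).1, sub_zero]
end

section
/- Let Ľ ⊆ Λ_K3 be a nondegenerate primitive sublattice, let F ∈ Ľ be a primitive isotropic element, and let τ ∈ Ľ^⊥ be a primitive isotropic element which is 1-admissible in Ľ^⊥. Then the embedding of Γ := F^⊥_Ľ/ℤF into (ℤF ⊕ ℤτ)^⊥/(ℤF ⊕ ℤτ) induced by the inclusion F^⊥_Ľ ⊆ (ℤF ⊕ ℤτ)^⊥ is primitive, i.e. the quotient of (ℤF ⊕ ℤτ)^⊥/(ℤF ⊕ ℤτ) by the image of Γ is torsion-free. -/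
open DF in
/-- The orthogonal complement reverses inclusions. -/
theorem perpSub_anti {G : Type} [AddCommGroup G] (B : Bil G) {S T : Submodule ℤ G} (h : S ≤ T) :
    perpSub B T ≤ perpSub B S :=
  fun _ hv s hs => hv s (h hs)

open DF in
/-- Let `Ľ ⊆ Λ_K3` be a nondegenerate primitive sublattice,
`F ∈ Ľ` primitive isotropic, and `τ ∈ Ľ^⊥` primitive isotropic and
`1`-admissible in `Ľ^⊥`. Then the embedding of `Γ = F^⊥_Ľ/ℤF` into
`(ℤF ⊕ ℤτ)^⊥/(ℤF ⊕ ℤτ)` induced by `F^⊥_Ľ ⊆ (ℤF ⊕ ℤτ)^⊥` is primitive: the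
quotient by the image of `Γ` is torsion-free. -/
theorem stmt18 (Lv : Submodule ℤ K3type) (hLnd : NondegOn K3Form Lv) (hLprim : PrimSub Lv)
    (F τ : K3type) (hFL : F ∈ Lv) (hFprim : PrimElt F) (hFiso : K3Form F F = 0)
    (hτ : MAdm K3Form (perpSub K3Form Lv) τ 1) :
    ∀ (z : ↥(perpSub K3Form (Submodule.span ℤ {F, τ})) ⧸
            Submodule.comap (perpSub K3Form (Submodule.span ℤ {F, τ})).subtype
              (Submodule.span ℤ {F, τ}))
      (n : ℤ), n ≠ 0 →
      (∃ y : ↥(perpSub K3Form (Submodule.span ℤ {F, τ})),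
        (y : K3type) ∈ Lv ⊓ perpSub K3Form (Submodule.span ℤ {F}) ∧
        n • z = Submodule.Quotient.mk y) →
      ∃ y : ↥(perpSub K3Form (Submodule.span ℤ {F, τ})),
        (y : K3type) ∈ Lv ⊓ perpSub K3Form (Submodule.span ℤ {F}) ∧
        z = Submodule.Quotient.mk y := by
  intro z n hn ⟨y, ⟨hyL, _⟩, hzy⟩
  obtain ⟨hτL, -, hττ, -, g, hg, -, -, hτg⟩ := hτ
  induction z using Submodule.Quotient.induction_on with
  | _ w =>
  rw [← Submodule.Quotient.mk_smul, Submodule.Quotient.eq, Submodule.mem_comap,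
    Submodule.mem_span_pair] at hzy
  obtain ⟨a, b, hab⟩ := hzy
  have hdecomp : n • (w : K3type) = (y : K3type) + a • F + b • τ := by
    have h : a • F + b • τ = n • (w : K3type) - (y : K3type) := by simpa using hab
    rw [add_assoc, h]; abel
  have hb : n * K3Form w g = b := by
    have h := congrArg (fun v => K3Form v g) hdecomp
    simpa [-zsmul_eq_mul, map_add, (hg _ hyL).1, (hg _ hFL).1, hτg] using h
  have hτperp : τ ∈ perpSub K3Form (Submodule.span ℤ {F, τ}) := by
    intro s hs
    obtain ⟨c, d, rfl⟩ := Submodule.mem_span_pair.1 hs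
    have hF := hτL F hFL
    constructor <;> simp [-zsmul_eq_mul, hF.1, hF.2, hττ]
  have hvperp := sub_mem w.2 (Submodule.smul_mem _ (K3Form w g) hτperp)
  have hvL : (w : K3type) - K3Form w g • τ ∈ Lv := by
    refine hLprim n _ hn ?_
    have h : n • ((w : K3type) - K3Form w g • τ) = (y : K3type) + a • F := by
      rw [smul_sub, smul_smul, hb, hdecomp, add_sub_cancel_right]
    rw [h]
    exact add_mem hyL (Submodule.smul_mem _ _ hFL)
  refine ⟨⟨_, hvperp⟩, ⟨hvL, perpSub_anti K3Form (Submodule.span_mono (by simp)) hvperp⟩, ?_⟩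
  rw [Submodule.Quotient.eq, Submodule.mem_comap, Submodule.mem_span_pair]
  exact ⟨0, K3Form w g, by simp⟩
end
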